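/- arXiv:1604.06664 — 4 statements merged into one kernel-verified Lean document; each statement's English description precedes it below -/
import Mathlib

section
/- Assume H1. Define ξ_θ(x) = √(π(x+θ)) for θ, x ∈ ℝ. Then there exists a constant C > 0 such that for all θ ∈ ℝ, (∫_ℝ (ξ_θ(x) − ξ_0(x) + θ V̇(x) ξ_0(x)/2)² dx)^{1/2} ≤ C|θ|^β, where β > 1 is the exponent from H1(i). (In particular the family θ ↦ π(·+θ) is differentiable in quadratic mean at θ = 0 with derivative V̇.) -/
open MeasureTheory ProbabilityTheory Filter Real
open scoped ENNReal NNReal Topology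

noncomputable section

/-- The normalized target density `π(x) = exp(-V(x)) / ∫ exp(-V(y)) dy`. -/
def piDen (V : ℝ → ℝ) (x : ℝ) : ℝ := Real.exp (-V x) / ∫ y : ℝ, Real.exp (-V y)

/-- The probability measure on `ℝ` with density `π`. -/
def piMeasure (V : ℝ → ℝ) : Measure ℝ :=
  MeasureTheory.volume.withDensity (fun x => ENNReal.ofReal (piDen V x))

theorem aux_exp2 (t : ℝ) : |Real.exp t - 1 - t| ≤ t ^ 2 * (1 + Real.exp t) := by
  have h1 : t + 1 ≤ Real.exp t := Real.add_one_le_exp t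
  have h2 : -t + 1 ≤ Real.exp (-t) := Real.add_one_le_exp (-t)
  have hpos := Real.exp_pos t
  have h3 : Real.exp t * Real.exp (-t) = 1 := by rw [← Real.exp_add]; simp
  have h4 : Real.exp t - 1 ≤ t * Real.exp t := by nlinarith
  rw [abs_of_nonneg (by linarith)]
  rcases le_total 0 t with h | h
  · nlinarith [mul_le_mul_of_nonneg_left h4 h, sq_nonneg t]
  · nlinarith [mul_le_mul_of_nonpos_left h1 h, mul_nonneg (sq_nonneg t) hpos.le]

theorem aux_exp3 (d : ℝ) : 1 - d + d ^ 2 / 2 - |d| ^ 3 ≤ Real.exp (-d) := by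
  rcases le_total d 0 with h | h
  · have := Real.quadratic_le_exp_of_nonneg (x := -d) (by linarith)
    have h3 : 0 ≤ |d| ^ 3 := by positivity
    nlinarith
  · rw [abs_of_nonneg h]
    rcases le_total d 1 with h1 | h1
    · have := Real.exp_bound (x := -d) (by rw [abs_neg, abs_of_nonneg h]; exact h1) (n := 3) (by norm_num)
      rw [abs_neg, abs_of_nonneg h] at this
      have := (abs_le.1 this).1
      simp [Finset.sum_range_succ, Nat.factorial] at this
      have h3 : 0 ≤ d ^ 3 := by positivity
      nlinarith
    · have := Real.exp_pos (-d)
      nlinarith [sq_nonneg d, mul_le_mul_of_nonneg_left h1 (sq_nonneg d)]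

theorem aux_moment {μ : Measure ℝ} [IsProbabilityMeasure μ] {f : ℝ → ℝ} (hf : Measurable f)
    {p B : ℝ} {q : ℕ} (hq : 1 ≤ q) (hqp : (q : ℝ) ≤ p)
    (hi : Integrable (fun x => |f x| ^ p) μ) (hB : (∫ x, |f x| ^ p ∂μ) ^ (1 / p) ≤ B) :
    Integrable (fun x => |f x| ^ q) μ ∧ ∫ x, |f x| ^ q ∂μ ≤ B ^ q := by
  have hq0 : (0 : ℝ) < q := by exact_mod_cast hq
  have hp0 : 0 < p := by linarith
  have hpe : ENNReal.ofReal p ≠ 0 := by simpa using hp0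
  have hm : MemLp f (ENNReal.ofReal p) μ := by
    rw [← integrable_norm_rpow_iff hf.aestronglyMeasurable hpe (by simp)]
    simpa [ENNReal.toReal_ofReal hp0.le] using hi
  have hle : (q : ℝ≥0∞) ≤ ENNReal.ofReal p := by
    rw [← ENNReal.ofReal_natCast]; exact ENNReal.ofReal_le_ofReal hqp
  have hmq : MemLp f (q : ℝ≥0∞) μ := hm.mono_exponent hle
  have hqe : (q : ℝ≥0∞) ≠ 0 := by simp; omega
  have e1 := eLpNorm_le_eLpNorm_of_exponent_le hle hf.aestronglyMeasurable (μ := μ)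
  rw [hm.eLpNorm_eq_integral_rpow_norm hpe (by simp),
    hmq.eLpNorm_eq_integral_rpow_norm hqe (by simp)] at e1
  simp only [ENNReal.toReal_ofReal hp0.le, ENNReal.toReal_natCast, Real.norm_eq_abs,
    Real.rpow_natCast] at e1
  have hP : 0 ≤ ∫ x, |f x| ^ p ∂μ := integral_nonneg fun x => by positivity
  have hQ : 0 ≤ ∫ x, |f x| ^ q ∂μ := integral_nonneg fun x => by positivity
  rw [ENNReal.ofReal_le_ofReal_iff (by positivity)] at e1
  refine ⟨by simpa using hmq.integrable_norm_pow (by omega), ?_⟩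
  have e2 : (∫ x, |f x| ^ q ∂μ) ^ (q : ℝ)⁻¹ ≤ B := e1.trans (by simpa using hB)
  have := pow_le_pow_left₀ (by positivity) e2 q
  rwa [Real.rpow_inv_natCast_pow hQ (by omega)] at this

theorem aux_sum4 (a b : ℝ) : (a + b) ^ 4 ≤ 8 * (|a| ^ 4 + |b| ^ 4) := by
  have h1 : |a| ^ 4 = a ^ 4 := by rw [← abs_pow]; exact abs_of_nonneg (by positivity)
  have h2 : |b| ^ 4 = b ^ 4 := by rw [← abs_pow]; exact abs_of_nonneg (by positivity)
  rw [h1, h2]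
  nlinarith [sq_nonneg (a - b), sq_nonneg (a + b), sq_nonneg (a ^ 2 - b ^ 2),
    mul_nonneg (sq_nonneg (a - b)) (sq_nonneg (a + b)),
    mul_nonneg (sq_nonneg (a - b)) (sq_nonneg (a - b)), sq_nonneg a, sq_nonneg b,
    mul_nonneg (sq_nonneg (a - b)) (sq_nonneg a), mul_nonneg (sq_nonneg (a - b)) (sq_nonneg b)]

theorem aux_sum3 (a b : ℝ) : |a + b| ^ 3 ≤ 4 * (|a| ^ 3 + |b| ^ 3) := by
  have h := pow_le_pow_left₀ (abs_nonneg _) (abs_add_le a b) 3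
  nlinarith [mul_nonneg (add_nonneg (abs_nonneg a) (abs_nonneg b)) (sq_nonneg (|a| - |b|))]

section bridge
variable {V : ℝ → ℝ}

theorem piDen_pos (hVint : Integrable (fun y => Real.exp (-V y))) (x : ℝ) : 0 < piDen V x :=
  div_pos (Real.exp_pos _) (integral_exp_pos hVint)

theorem piDen_meas (hV : Measurable V) : Measurable (piDen V) := by
  unfold piDen; fun_prop

theorem piDen_integrable (hVint : Integrable (fun y => Real.exp (-V y))) :
    Integrable (piDen V) := hVint.div_const _

theorem piDen_integral (hVint : Integrable (fun y => Real.exp (-V y))) :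
    ∫ x, piDen V x = 1 := by
  unfold piDen
  rw [integral_div, div_self (integral_exp_pos hVint).ne']

theorem piMeasure_prob (hVint : Integrable (fun y => Real.exp (-V y))) :
    IsProbabilityMeasure (piMeasure V) := by
  constructor
  rw [piMeasure, withDensity_apply _ MeasurableSet.univ, Measure.restrict_univ,
    ← ofReal_integral_eq_lintegral_ofReal (piDen_integrable hVint)
      (ae_of_all _ fun x => (piDen_pos hVint x).le), piDen_integral hVint]
  simp

theorem pi_integrable_iff (hV : Measurable V) (hVint : Integrable (fun y => Real.exp (-V y)))
    (g : ℝ → ℝ) : Integrable g (piMeasure V) ↔ Integrable (fun x => piDen V x * g x) := by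
  rw [piMeasure, integrable_withDensity_iff_integrable_smul' (piDen_meas hV).ennreal_ofReal
    (ae_of_all _ fun x => by simp)]
  simp [ENNReal.toReal_ofReal (piDen_pos hVint _).le]

theorem pi_integral (hV : Measurable V) (hVint : Integrable (fun y => Real.exp (-V y)))
    (g : ℝ → ℝ) : ∫ x, g x ∂(piMeasure V) = ∫ x, piDen V x * g x := by
  rw [piMeasure, integral_withDensity_eq_integral_toReal_smul (piDen_meas hV).ennreal_ofReal
    (ae_of_all _ fun x => by simp)]
  simp [ENNReal.toReal_ofReal (piDen_pos hVint _).le]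

theorem piDen_shift (x θ : ℝ) :
    piDen V (x + θ) = piDen V x * Real.exp (-(V (x + θ) - V x)) := by
  unfold piDen
  rw [div_mul_eq_mul_div, ← Real.exp_add]; congr 2; ring

theorem sqrt_piDen_shift (x θ : ℝ) :
    √(piDen V (x + θ)) = √(piDen V x) * Real.exp (-(V (x + θ) - V x) / 2) := by
  rw [piDen_shift, Real.sqrt_mul' _ (Real.exp_pos _).le, Real.exp_half]

end bridge

/-- pointwise bound of the integrand -/
theorem aux_pointwise {V : ℝ → ℝ} (hVint : Integrable (fun y => Real.exp (-V y)))
    (x θ v : ℝ) :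
    (√(piDen V (x + θ)) - √(piDen V x) + θ * v * √(piDen V x) / 2) ^ 2 ≤
      piDen V x * |V (x + θ) - V x - θ * v| ^ 2 + piDen V x * (V (x + θ) - V x) ^ 4
        + piDen V (x + θ) * (V (x + θ) - V x) ^ 4 := by
  have hs := sqrt_piDen_shift (V := V) x θ
  have h1 := Real.sq_sqrt (piDen_pos hVint x).le
  have h2 := Real.sq_sqrt (piDen_pos hVint (x + θ)).le
  rw [hs]
  set s := √(piDen V x)
  set d := V (x + θ) - V x
  set E := Real.exp (-d / 2) with hE
  have hk := aux_exp2 (-d / 2)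
  rw [← hE] at hk
  have hEp : 0 < E := Real.exp_pos _
  have key : (E - 1 + θ * v / 2) ^ 2 ≤ |d - θ * v| ^ 2 + d ^ 4 + E ^ 2 * d ^ 4 := by
    rw [sq_abs]
    have hk2 := sq_le_sq' (by linarith [neg_abs_le (E - 1 - -d / 2), (abs_le.1 hk).1]) (abs_le.1 hk).2
    set w := E - 1 - -d / 2 with hw
    have e : E - 1 + θ * v / 2 = w - (d - θ * v) / 2 := by rw [hw]; ring
    rw [e]
    have h3 : ((-d / 2) ^ 2 * (1 + E)) ^ 2 ≤ d ^ 4 / 8 * (1 + E ^ 2) := by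
      have : 0 ≤ d ^ 4 / 16 * (1 - E) ^ 2 := by positivity
      nlinarith
    have h4 : 0 ≤ d ^ 4 * (1 + E ^ 2) := by positivity
    nlinarith [sq_nonneg (w + (d - θ * v) / 2), sq_nonneg (d - θ * v)]
  have := mul_le_mul_of_nonneg_left key (sq_nonneg s)
  have e2 : piDen V (x + θ) = (s * E) ^ 2 := by rw [← hs, h2]
  rw [e2, ← h1]
  nlinarith

/-- If `β > 2`, the second moment of `V̇` vanishes. -/
theorem aux_degenerate {V Vdot : ℝ → ℝ} (hV : Measurable V)
    (hVint : Integrable (fun y => Real.exp (-V y))) {C β : ℝ} (hC : 0 < C) (hβ : 2 < β)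
    (hr : ∀ q : ℕ, 1 ≤ q → q ≤ 4 → ∀ θ : ℝ,
      Integrable (fun x => |V (x + θ) - V x - θ * Vdot x| ^ q) (piMeasure V) ∧
      ∫ x, |V (x + θ) - V x - θ * Vdot x| ^ q ∂(piMeasure V) ≤ (C * |θ| ^ β) ^ q)
    (hv : ∀ q : ℕ, 1 ≤ q → q ≤ 4 → Integrable (fun x => |Vdot x| ^ q) (piMeasure V))
    (hv1 : Integrable Vdot (piMeasure V)) :
    ∫ x, |Vdot x| ^ 2 ∂(piMeasure V) ≤ 0 := by
  haveI := piMeasure_prob hVint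
  set A2 := ∫ x, |Vdot x| ^ 2 ∂(piMeasure V) with hA2
  set A3 := ∫ x, |Vdot x| ^ 3 ∂(piMeasure V) with hA3
  set a := ∫ x, Vdot x ∂(piMeasure V) with ha
  have hexp : ∀ θ : ℝ,
      Integrable (fun x => Real.exp (-(V (x + θ) - V x))) (piMeasure V) ∧
      ∫ x, Real.exp (-(V (x + θ) - V x)) ∂(piMeasure V) = 1 := by
    intro θ
    rw [pi_integrable_iff hV hVint, pi_integral hV hVint]
    simp only [← piDen_shift]
    refine ⟨(piDen_integrable hVint).comp_add_right θ, ?_⟩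
    rw [integral_add_right_eq_self (piDen V) θ, piDen_integral hVint]
  have step : ∀ θ : ℝ, θ ^ 2 * A2 / 4 ≤ θ * a + C * |θ| ^ β + 4 * (|θ| ^ 3 * A3)
      + 4 * (C * |θ| ^ β) ^ 3 + (C * |θ| ^ β) ^ 2 / 2 := by
    intro θ
    obtain ⟨ie, he⟩ := hexp θ
    obtain ⟨i1, h1⟩ := hr 1 (by norm_num) (by norm_num) θ
    obtain ⟨i2, h2⟩ := hr 2 (by norm_num) (by norm_num) θ
    obtain ⟨i3, h3⟩ := hr 3 (by norm_num) (by norm_num) θ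
    have j2 := hv 2 (by norm_num) (by norm_num)
    have j3 := hv 3 (by norm_num) (by norm_num)
    have iL : Integrable (fun x => θ ^ 2 / 4 * |Vdot x| ^ 2) (piMeasure V) := j2.const_mul _
    have k1 := ie.sub (integrable_const (1 : ℝ))
    have k2 := k1.add (hv1.const_mul θ)
    have k3 := k2.add i1
    have k4 := k3.add (j3.const_mul (4 * |θ| ^ 3))
    have k5 := k4.add (i3.const_mul 4)
    have k6 := k5.add (i2.const_mul (1 / 2))
    have hmono := integral_mono iL k6 (by
      intro x
      simp only [Pi.add_apply, Pi.sub_apply]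
      set v := Vdot x
      set d := V (x + θ) - V x
      have e3 := aux_exp3 d
      have s3 := aux_sum3 (θ * v) (d - θ * v)
      rw [add_sub_cancel, abs_mul, mul_pow] at s3
      have l1 := le_abs_self (d - θ * v)
      rw [sq_abs, sq_abs, pow_one]
      nlinarith [sq_nonneg (d + (d - θ * v))])
    rw [integral_add' k5 (i2.const_mul (1 / 2)), integral_add' k4 (i3.const_mul 4),
      integral_add' k3 (j3.const_mul (4 * |θ| ^ 3)), integral_add' k2 i1,
      integral_add' k1 (hv1.const_mul θ), integral_sub' ie (integrable_const (1 : ℝ)), he] at hmono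
    simp only [integral_const_mul] at hmono
    rw [← hA2, ← hA3, ← ha] at hmono
    simp only [integral_const, probReal_univ, smul_eq_mul] at hmono
    rw [pow_one (C * |θ| ^ β)] at h1
    linarith
  have step2 : ∀ θ : ℝ, 0 < θ → θ ≤ 1 →
      A2 ≤ 4 * ((C + 4 * C ^ 3 + C ^ 2 / 2) * θ ^ (β - 2) + 4 * A3 * θ) := by
    intro θ h0 h1
    have p1 := step θ
    have p2 := step (-θ)
    rw [abs_neg] at p2
    rw [abs_of_pos h0] at p1 p2
    have et : θ ^ β = θ ^ 2 * θ ^ (β - 2) := by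
      rw [← Real.rpow_natCast, ← Real.rpow_add h0]; congr 1; push_cast; ring
    have t1 : θ ^ β ≤ 1 := Real.rpow_le_one h0.le h1 (by linarith)
    have t0 : 0 ≤ θ ^ β := by positivity
    set t := θ ^ β
    have t2 : t ^ 2 ≤ t := by nlinarith
    have t3 : t ^ 3 ≤ t := by nlinarith
    have c3 : C ^ 3 * t ^ 3 ≤ C ^ 3 * t := mul_le_mul_of_nonneg_left t3 (by positivity)
    have c2 : C ^ 2 * t ^ 2 ≤ C ^ 2 * t := mul_le_mul_of_nonneg_left t2 (by positivity)
    have fin : θ ^ 2 * A2 ≤ θ ^ 2 *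
        (4 * ((C + 4 * C ^ 3 + C ^ 2 / 2) * θ ^ (β - 2) + 4 * A3 * θ)) := by
      have : θ ^ 2 * (4 * ((C + 4 * C ^ 3 + C ^ 2 / 2) * θ ^ (β - 2) + 4 * A3 * θ)) =
        4 * ((C + 4 * C ^ 3 + C ^ 2 / 2) * t + 4 * A3 * θ ^ 3) := by rw [et]; ring
      rw [this]
      nlinarith
    exact le_of_mul_le_mul_left fin (by positivity)
  have lim : Tendsto (fun θ : ℝ => 4 * ((C + 4 * C ^ 3 + C ^ 2 / 2) * θ ^ (β - 2) + 4 * A3 * θ))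
      (𝓝[>] 0) (𝓝 0) := by
    have c : ContinuousAt
        (fun θ : ℝ => 4 * ((C + 4 * C ^ 3 + C ^ 2 / 2) * θ ^ (β - 2) + 4 * A3 * θ)) 0 := by
      have : ContinuousAt (fun θ : ℝ => θ ^ (β - 2)) 0 :=
        Real.continuousAt_rpow_const _ _ (Or.inr (by linarith))
      fun_prop
    have c2 := c.tendsto
    simp only [Real.zero_rpow (show β - 2 ≠ 0 by linarith), mul_zero, add_zero] at c2
    exact c2.mono_left nhdsWithin_le_nhds
  refine ge_of_tendsto lim ?_
  filter_upwards [Ioc_mem_nhdsGT (zero_lt_one' ℝ)] with θ hθ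
  exact step2 θ hθ.1 hθ.2

/-- Lemma 1 (DQM): under H1, the family `θ ↦ π(· + θ)` is differentiable in quadratic
mean at `θ = 0` with derivative `V̇`. -/
theorem stmt_0 (V Vdot : ℝ → ℝ) (hV : Measurable V) (hVdot : Measurable Vdot)
    (hVint : Integrable (fun y => Real.exp (-V y)))
    (p C β : ℝ) (hp : 4 < p) (hC : 0 < C) (hβ : 1 < β)
    (hH1i : ∀ θ : ℝ,
      Integrable (fun x => |V (x + θ) - V x - θ * Vdot x| ^ p) (piMeasure V) ∧
      (∫ x, |V (x + θ) - V x - θ * Vdot x| ^ p ∂(piMeasure V)) ^ (1 / p) ≤ C * |θ| ^ β)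
    (hH1ii : Integrable (fun x => |Vdot x| ^ (6 : ℝ)) (piMeasure V)) :
    ∃ C' > 0, ∀ θ : ℝ,
      Real.sqrt (∫ x : ℝ,
        (Real.sqrt (piDen V (x + θ)) - Real.sqrt (piDen V x)
          + θ * Vdot x * Real.sqrt (piDen V x) / 2) ^ 2) ≤ C' * |θ| ^ β := by
  haveI := piMeasure_prob hVint
  have hr : ∀ q : ℕ, 1 ≤ q → q ≤ 4 → ∀ θ : ℝ,
      Integrable (fun x => |V (x + θ) - V x - θ * Vdot x| ^ q) (piMeasure V) ∧
      ∫ x, |V (x + θ) - V x - θ * Vdot x| ^ q ∂(piMeasure V) ≤ (C * |θ| ^ β) ^ q := by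
    intro q h1 h4 θ
    have hq4 : (q : ℝ) ≤ 4 := by exact_mod_cast h4
    exact aux_moment (by fun_prop) h1 (by linarith) (hH1i θ).1 (hH1i θ).2
  have hv : ∀ q : ℕ, 1 ≤ q → q ≤ 4 → Integrable (fun x => |Vdot x| ^ q) (piMeasure V) := by
    intro q h1 h4
    have hq4 : (q : ℝ) ≤ 4 := by exact_mod_cast h4
    exact (aux_moment hVdot h1 (by linarith) hH1ii le_rfl).1
  have hv1 : Integrable Vdot (piMeasure V) := by
    have := hv 1 le_rfl (by norm_num)
    simp only [pow_one] at this
    exact (integrable_norm_iff hVdot.aestronglyMeasurable).1 this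
  set A2 := ∫ x, |Vdot x| ^ 2 ∂(piMeasure V) with hA2
  set A4 := ∫ x, |Vdot x| ^ 4 ∂(piMeasure V) with hA4
  have A2nn : 0 ≤ A2 := integral_nonneg fun x => by positivity
  have A4nn : 0 ≤ A4 := integral_nonneg fun x => by positivity
  have hdeg : 2 < β → A4 = 0 := by
    intro hb
    have h0 : A2 = 0 := le_antisymm (aux_degenerate hV hVint hC hb hr hv hv1) A2nn
    have hae := (integral_eq_zero_iff_of_nonneg (fun x => by positivity)
      (hv 2 (by norm_num) (by norm_num))).1 h0
    refine integral_eq_zero_of_ae ?_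
    filter_upwards [hae] with x hx
    simp at hx
    simp [hx]
  have hD : ∀ θ : ℝ, Integrable (fun x => (V (x + θ) - V x) ^ 4) (piMeasure V) ∧
      ∫ x, (V (x + θ) - V x) ^ 4 ∂(piMeasure V) ≤ 8 * (|θ| ^ 4 * A4 + (C * |θ| ^ β) ^ 4) := by
    intro θ
    obtain ⟨i4, h4⟩ := hr 4 (by norm_num) (by norm_num) θ
    have j4 := hv 4 (by norm_num) (by norm_num)
    have iR := ((j4.const_mul (|θ| ^ 4)).add i4).const_mul 8
    have pw : ∀ x, (V (x + θ) - V x) ^ 4 ≤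
        8 * (|θ| ^ 4 * |Vdot x| ^ 4 + |V (x + θ) - V x - θ * Vdot x| ^ 4) := by
      intro x
      have := aux_sum4 (θ * Vdot x) (V (x + θ) - V x - θ * Vdot x)
      rwa [add_sub_cancel, abs_mul, mul_pow] at this
    have iD : Integrable (fun x => (V (x + θ) - V x) ^ 4) (piMeasure V) := by
      refine iR.mono' (by fun_prop) (ae_of_all _ fun x => ?_)
      rw [Real.norm_of_nonneg (by positivity)]
      exact pw x
    refine ⟨iD, (integral_mono iD iR pw).trans ?_⟩
    rw [integral_const_mul, integral_add' (j4.const_mul (|θ| ^ 4)) i4, integral_const_mul]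
    linarith
  have hS : ∀ θ : ℝ, Integrable (fun x => piDen V (x + θ) * (V (x + θ) - V x) ^ 4) ∧
      ∫ x, piDen V (x + θ) * (V (x + θ) - V x) ^ 4 ≤
        8 * (|θ| ^ 4 * A4 + (C * |θ| ^ β) ^ 4) := by
    intro θ
    obtain ⟨i, h⟩ := hD (-θ)
    rw [pi_integrable_iff hV hVint] at i
    rw [pi_integral hV hVint, abs_neg] at h
    have e : (fun x => piDen V (x + θ) * (V (x + θ) - V x) ^ 4) =
        fun x => (fun y => piDen V y * (V (y + -θ) - V y) ^ 4) (x + θ) := by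
      funext x
      simp only [add_neg_cancel_right]
      ring
    rw [e]
    refine ⟨i.comp_add_right θ, ?_⟩
    rw [integral_add_right_eq_self (fun y => piDen V y * (V (y + -θ) - V y) ^ 4) θ]
    exact h
  set K := C ^ 2 + 16 * A4 + 16 * C ^ 4 + 6 + 3 * A2 with hK
  have Kpos : 0 < K := by positivity
  refine ⟨√K, Real.sqrt_pos.2 Kpos, fun θ => ?_⟩
  have tnn : 0 ≤ |θ| ^ β := by positivity
  suffices hmain : ∫ x : ℝ, (√(piDen V (x + θ)) - √(piDen V x)
      + θ * Vdot x * √(piDen V x) / 2) ^ 2 ≤ K * (|θ| ^ β) ^ 2 by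
    refine (Real.sqrt_le_sqrt hmain).trans ?_
    rw [Real.sqrt_mul Kpos.le, Real.sqrt_sq tnn]
  rcases le_total |θ| 1 with h1 | h1
  · obtain ⟨i2, h2⟩ := hr 2 (by norm_num) (by norm_num) θ
    obtain ⟨iD, hDθ⟩ := hD θ
    obtain ⟨iS, hSθ⟩ := hS θ
    rw [pi_integrable_iff hV hVint] at i2 iD
    rw [pi_integral hV hVint] at h2 hDθ
    have hm := integral_mono_of_nonneg (ae_of_all _ fun x => sq_nonneg _)
      ((i2.add iD).add iS) (ae_of_all _ fun x => aux_pointwise hVint x θ (Vdot x))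
    rw [integral_add' (i2.add iD) iS, integral_add' i2 iD] at hm
    have t1 : |θ| ^ β ≤ 1 := Real.rpow_le_one (abs_nonneg _) h1 (by linarith)
    have hA : |θ| ^ 4 * A4 ≤ A4 * (|θ| ^ β) ^ 2 := by
      rcases le_or_gt β 2 with hb | hb
      · have : |θ| ^ 2 ≤ |θ| ^ β := by
          rcases (abs_nonneg θ).eq_or_lt with h0 | h0
          · rw [← h0, Real.zero_rpow (by linarith)]; norm_num
          · rw [← Real.rpow_natCast]
            exact Real.rpow_le_rpow_of_exponent_ge h0 h1 (by exact_mod_cast hb)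
        have := pow_le_pow_left₀ (by positivity) this 2
        rw [← pow_mul] at this
        rw [mul_comm]
        exact mul_le_mul_of_nonneg_left this A4nn
      · rw [hdeg hb]; simp
    refine hm.trans ?_
    set t := |θ| ^ β
    have t4 : C ^ 4 * t ^ 4 ≤ C ^ 4 * t ^ 2 :=
      mul_le_mul_of_nonneg_left (pow_le_pow_of_le_one tnn t1 (by norm_num)) (by positivity)
    have : 0 ≤ (6 + 3 * A2) * t ^ 2 := by positivity
    rw [mul_pow] at h2 hDθ hSθ
    rw [hK]
    linarith
  · have j2 := hv 2 (by norm_num) (by norm_num)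
    have e2 : A2 = ∫ x, piDen V x * |Vdot x| ^ 2 := pi_integral hV hVint _
    rw [pi_integrable_iff hV hVint] at j2
    have q1 := piDen_integrable hVint
    have q2 := q1.comp_add_right θ
    have hm := integral_mono_of_nonneg (ae_of_all _ fun x => sq_nonneg _)
      (((q2.add q1).add (j2.const_mul (θ ^ 2))).const_mul 3)
      (f := fun x => (√(piDen V (x + θ)) - √(piDen V x) + θ * Vdot x * √(piDen V x) / 2) ^ 2)
      (ae_of_all _ fun x => by
        simp only [Pi.add_apply]
        have g1 := Real.sq_sqrt (piDen_pos hVint x).le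
        have g2 := Real.sq_sqrt (piDen_pos hVint (x + θ)).le
        rw [sq_abs]
        set s := √(piDen V x)
        set u := √(piDen V (x + θ))
        rw [← g1, ← g2]
        nlinarith [sq_nonneg (u + s), sq_nonneg (u - θ * Vdot x * s / 2),
          sq_nonneg (s + θ * Vdot x * s / 2), sq_nonneg (θ * Vdot x * s)])
    rw [integral_const_mul, integral_add' (q2.add q1) (j2.const_mul (θ ^ 2)),
      integral_add' q2 q1, integral_const_mul, ← e2, piDen_integral hVint,
      integral_add_right_eq_self (piDen V) θ, piDen_integral hVint] at hm
    refine hm.trans ?_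
    have t1 : |θ| ≤ |θ| ^ β := Real.self_le_rpow_of_one_le h1 hβ.le
    have t2 : θ ^ 2 ≤ (|θ| ^ β) ^ 2 := by
      rw [← sq_abs θ]; exact pow_le_pow_left₀ (abs_nonneg _) t1 2
    have t3 : 1 ≤ (|θ| ^ β) ^ 2 := one_le_pow₀ (h1.trans t1)
    set t := |θ| ^ β
    have : 0 ≤ (C ^ 2 + 16 * A4 + 16 * C ^ 4) * t ^ 2 := by positivity
    have := mul_le_mul_of_nonneg_left t2 A2nn
    rw [hK]
    linarith
end
end

section
/- Assume H1. Let X be a real random variable with density π and Z an independent standard Gaussian random variable. Then lim_{d→∞} d · E[(ζ^d(X,Z) + ℓ Z V̇(X)/(2√d))²] = 0. -/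
open MeasureTheory ProbabilityTheory Filter Real
open scoped ENNReal NNReal Topology

noncomputable section

/-- `ζ^d(x,z) = exp((V(x) - V(x + ℓ d^{-1/2} z))/2) - 1`. -/
def zeta (V : ℝ → ℝ) (ℓ : ℝ) (d : ℕ) (x z : ℝ) : ℝ :=
  Real.exp ((V x - V (x + ℓ * z / Real.sqrt d)) / 2) - 1

/-- The standard normal cumulative distribution function `Φ`. -/
def stdGaussCDF (s : ℝ) : ℝ := (gaussianReal 0 1 (Set.Iic s)).toReal

lemma aux_prob (V : ℝ → ℝ) (hVint : Integrable (fun y => Real.exp (-V y))) :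
    IsProbabilityMeasure (piMeasure V) := by
  have hZ : 0 < ∫ y : ℝ, Real.exp (-V y) := integral_exp_pos hVint
  constructor
  rw [piMeasure, withDensity_apply _ MeasurableSet.univ, Measure.restrict_univ,
    ← ofReal_integral_eq_lintegral_ofReal]
  · simp only [piDen, integral_div]
    rw [div_self hZ.ne']; simp
  · exact hVint.div_const _
  · exact Eventually.of_forall fun x => by unfold piDen; positivity

lemma aux_exp (u : ℝ) : (Real.exp u - 1 - u) ^ 2 ≤ u ^ 4 * (1 + Real.exp (2 * u)) := by
  have h1 : 0 ≤ Real.exp u - 1 - u := by linarith [Real.add_one_le_exp u]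
  have h0 := Real.exp_pos u
  have h3 : Real.exp u - 1 ≤ u * Real.exp u := by
    have h := Real.add_one_le_exp (-u)
    have : Real.exp (-u) * Real.exp u = 1 := by rw [← Real.exp_add]; simp
    nlinarith
  have h2 : Real.exp u - 1 - u ≤ u * (Real.exp u - 1) := by linarith
  have h4 : (Real.exp u - 1) ^ 2 ≤ u ^ 2 * (1 + Real.exp (2 * u)) := by
    have he : Real.exp (2 * u) = Real.exp u ^ 2 := by rw [← Real.exp_nat_mul]; norm_cast
    rw [he]
    rcases le_total 0 u with hu | hu
    · have : 0 ≤ Real.exp u - 1 := by linarith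
      nlinarith [pow_le_pow_left₀ this h3 2, sq_nonneg u]
    · have : 0 ≤ 1 - Real.exp u := by linarith [Real.exp_le_one_iff.2 hu]
      have h5 : 1 - Real.exp u ≤ -u := by linarith
      nlinarith [pow_le_pow_left₀ this h5 2, sq_nonneg (u * Real.exp u)]
  calc _ ≤ (u * (Real.exp u - 1)) ^ 2 := pow_le_pow_left₀ h1 h2 2
    _ = u ^ 2 * (Real.exp u - 1) ^ 2 := by ring
    _ ≤ u ^ 2 * (u ^ 2 * (1 + Real.exp (2 * u))) := by gcongr
    _ = _ := by ring

lemma aux_pt (D w : ℝ) :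
    (Real.exp (-D / 2) - 1 + w / 2) ^ 2 ≤ D ^ 4 + D ^ 4 * Real.exp (-D) + (D - w) ^ 2 := by
  have h := aux_exp (-D / 2)
  rw [show 2 * (-D / 2) = -D by ring] at h
  have h4 : 0 ≤ D ^ 4 * Real.exp (-D) := by positivity
  have h5 : 0 ≤ D ^ 4 := by positivity
  have h6 : (-D / 2) ^ 4 * (1 + Real.exp (-D)) = (D ^ 4 + D ^ 4 * Real.exp (-D)) / 16 := by ring
  rw [h6] at h
  nlinarith [sq_nonneg ((Real.exp (-D / 2) - 1 - (-D / 2)) - (w - D) / 2), sq_nonneg (D - w)]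

lemma aux_shift (V : ℝ → ℝ) (hV : Measurable V) (θ : ℝ) :
    ∫⁻ x, ENNReal.ofReal ((V (x + θ) - V x) ^ 4 * Real.exp (-(V (x + θ) - V x))) ∂(piMeasure V)
      = ∫⁻ x, ENNReal.ofReal ((V (x + -θ) - V x) ^ 4) ∂(piMeasure V) := by
  have hm : Measurable (fun x => ENNReal.ofReal (piDen V x)) := by unfold piDen; fun_prop
  have hZ : 0 ≤ ∫ y : ℝ, Real.exp (-V y) := integral_nonneg fun _ => (Real.exp_pos _).le
  have hp : ∀ x, 0 ≤ piDen V x := fun x => by unfold piDen; positivity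
  rw [piMeasure, lintegral_withDensity_eq_lintegral_mul _ hm (by fun_prop),
    lintegral_withDensity_eq_lintegral_mul _ hm (by fun_prop)]
  symm
  rw [← lintegral_add_right_eq_self _ θ]
  refine lintegral_congr fun x => ?_
  simp only [Pi.mul_apply]
  rw [← ENNReal.ofReal_mul (hp _), ← ENNReal.ofReal_mul (hp _)]
  congr 1
  rw [show x + θ + -θ = x by ring]
  have : piDen V (x + θ) = piDen V x * Real.exp (-(V (x + θ) - V x)) := by
    unfold piDen
    rw [div_mul_eq_mul_div, ← Real.exp_add]; congr 2; ring
  rw [this]; ring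

lemma aux_lyap {μ : Measure ℝ} [IsProbabilityMeasure μ] (R : ℝ → ℝ) (hR : Measurable R)
    (p B : ℝ) (hp : 4 < p) (hB : 0 ≤ B) (hi : Integrable (fun x => |R x| ^ p) μ)
    (hb : (∫ x, |R x| ^ p ∂μ) ^ (1 / p) ≤ B) (n : ℕ) (hn0 : n ≠ 0) (hn : n ≤ 4) :
    ∫⁻ x, ENNReal.ofReal (|R x| ^ n) ∂μ ≤ ENNReal.ofReal (B ^ n) := by
  have hp0 : 0 < p := by linarith
  have hp1 : ENNReal.ofReal p ≠ 0 := by simpa using hp0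
  have hm : MemLp R (ENNReal.ofReal p) μ := by
    rw [← integrable_norm_rpow_iff hR.aestronglyMeasurable hp1 ENNReal.ofReal_ne_top,
      ENNReal.toReal_ofReal hp0.le]
    exact hi
  have h1 : eLpNorm R (ENNReal.ofReal p) μ ≤ ENNReal.ofReal B := by
    rw [hm.eLpNorm_eq_integral_rpow_norm hp1 ENNReal.ofReal_ne_top, ENNReal.toReal_ofReal hp0.le]
    refine ENNReal.ofReal_le_ofReal ?_
    simpa [one_div] using hb
  have h2 : eLpNorm R (n : ℝ≥0∞) μ ≤ eLpNorm R (ENNReal.ofReal p) μ := by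
    refine eLpNorm_le_eLpNorm_of_exponent_le ?_ hR.aestronglyMeasurable
    rw [← ENNReal.ofReal_natCast]
    refine ENNReal.ofReal_le_ofReal ?_
    have : (n : ℝ) ≤ 4 := by exact_mod_cast hn
    linarith
  have h3 : ∫⁻ x, ENNReal.ofReal (|R x| ^ n) ∂μ = eLpNorm R (n : ℝ≥0∞) μ ^ n := by
    have hn' : (n : ℝ) ≠ 0 := by exact_mod_cast hn0
    rw [eLpNorm_eq_lintegral_rpow_enorm_toReal (by exact_mod_cast hn0) (by simp)]
    rw [← ENNReal.rpow_natCast, ← ENNReal.rpow_mul]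
    simp only [ENNReal.toReal_natCast, one_div, inv_mul_cancel₀ hn', ENNReal.rpow_one,
      ENNReal.rpow_natCast]
    refine lintegral_congr fun x => ?_
    rw [ENNReal.ofReal_pow (abs_nonneg _), ← Real.norm_eq_abs, ofReal_norm]
  rw [h3, ENNReal.ofReal_pow hB]
  exact pow_le_pow_left' (h2.trans h1) n

lemma aux_gauss_int (s c : ℝ) (hs : 0 < s) :
    Integrable (fun z : ℝ => |c * z| ^ s) (gaussianReal 0 1) := by
  have h : MemLp (fun z : ℝ => z) (s.toNNReal : ℝ≥0∞) (gaussianReal 0 1) :=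
    memLp_id_gaussianReal _
  have h2 := (h.const_mul c).integrable_norm_rpow (by simpa using hs) (by simp)
  simpa [max_eq_left hs.le] using h2

lemma aux_gauss_lim (s ℓ : ℝ) (hs : 2 < s) (hℓ : 0 < ℓ) :
    Tendsto (fun d : ℕ => (d : ℝ) * ∫ z, |ℓ * z / Real.sqrt d| ^ s ∂(gaussianReal 0 1))
      atTop (𝓝 0) := by
  have h1 : Tendsto (fun d : ℕ => (d : ℝ) ^ (-(s / 2 - 1)) *
      ∫ z, |ℓ * z| ^ s ∂(gaussianReal 0 1)) atTop (𝓝 (0 * _)) :=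
    ((tendsto_rpow_neg_atTop (by linarith)).comp tendsto_natCast_atTop_atTop).mul_const _
  rw [zero_mul] at h1
  refine h1.congr' ?_
  filter_upwards [eventually_gt_atTop 0] with d hd
  have hd' : (0 : ℝ) < d := by exact_mod_cast hd
  have : ∀ z : ℝ, |ℓ * z / Real.sqrt d| ^ s = |ℓ * z| ^ s * (d : ℝ) ^ (-(s / 2)) := by
    intro z
    rw [abs_div, Real.div_rpow (abs_nonneg _) (abs_nonneg _), abs_of_nonneg (Real.sqrt_nonneg _),
      Real.sqrt_eq_rpow, ← Real.rpow_mul hd'.le, Real.rpow_neg hd'.le, div_eq_mul_inv]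
    congr 3; ring
  simp only [this]
  rw [integral_mul_const, show -(s / 2 - 1) = 1 + -(s / 2) by ring, Real.rpow_add hd',
    Real.rpow_one]
  ring

/-- bound at fixed shift -/
lemma aux_fixed
    (V Vdot : ℝ → ℝ) (hV : Measurable V) (hVdot : Measurable Vdot)
    (hVint : Integrable (fun y => Real.exp (-V y)))
    (p C β : ℝ) (hp : 4 < p) (hC : 0 < C)
    (hH1i : ∀ θ : ℝ,
      Integrable (fun x => |V (x + θ) - V x - θ * Vdot x| ^ p) (piMeasure V) ∧
      (∫ x, |V (x + θ) - V x - θ * Vdot x| ^ p ∂(piMeasure V)) ^ (1 / p) ≤ C * |θ| ^ β)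
    (hH1ii : Integrable (fun x => |Vdot x| ^ (6 : ℝ)) (piMeasure V)) :
    ∃ M : ℝ, 0 ≤ M ∧ ∀ θ : ℝ,
      ∫⁻ x, ENNReal.ofReal ((Real.exp (-(V (x + θ) - V x) / 2) - 1 + θ * Vdot x / 2) ^ 2)
        ∂(piMeasure V) ≤ ENNReal.ofReal (16 * C ^ 4 * |θ| ^ (β * 4) + M * |θ| ^ (4 : ℝ)
          + C ^ 2 * |θ| ^ (β * 2)) := by
  have := aux_prob V hVint
  set B := (∫ x, |Vdot x| ^ (6 : ℝ) ∂(piMeasure V)) ^ (1 / (6 : ℝ)) with hB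
  have hB0 : 0 ≤ B := by positivity
  have hW : ∫⁻ x, ENNReal.ofReal (|Vdot x| ^ 4) ∂(piMeasure V) ≤ ENNReal.ofReal (B ^ 4) :=
    aux_lyap Vdot hVdot 6 B (by norm_num) hB0 hH1ii le_rfl 4 (by norm_num) le_rfl
  have hRn : ∀ θ : ℝ, ∀ n : ℕ, n ≠ 0 → n ≤ 4 →
      ∫⁻ x, ENNReal.ofReal (|V (x + θ) - V x - θ * Vdot x| ^ n) ∂(piMeasure V)
        ≤ ENNReal.ofReal ((C * |θ| ^ β) ^ n) := fun θ n h0 h4 =>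
    aux_lyap (fun x => V (x + θ) - V x - θ * Vdot x) (by fun_prop) p _ hp (by positivity)
      (hH1i θ).1 (hH1i θ).2 n h0 h4
  have hD : ∀ θ : ℝ, ∫⁻ x, ENNReal.ofReal ((V (x + θ) - V x) ^ 4) ∂(piMeasure V)
      ≤ ENNReal.ofReal (8 * (C * |θ| ^ β) ^ 4 + 8 * (|θ| ^ 4 * B ^ 4)) := by
    intro θ
    calc _ ≤ ∫⁻ x, (ENNReal.ofReal 8 * ENNReal.ofReal (|V (x + θ) - V x - θ * Vdot x| ^ 4)
          + ENNReal.ofReal (8 * |θ| ^ 4) * ENNReal.ofReal (|Vdot x| ^ 4)) ∂(piMeasure V) := by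
          refine lintegral_mono fun x => ?_
          rw [← ENNReal.ofReal_mul (by norm_num), ← ENNReal.ofReal_mul (by positivity),
            ← ENNReal.ofReal_add (by positivity) (by positivity)]
          refine ENNReal.ofReal_le_ofReal ?_
          have e4 : ∀ t : ℝ, |t| ^ 4 = t ^ 4 := fun t => (Even.pow_abs (by decide) t)
          rw [e4, e4, e4, mul_assoc, ← mul_pow]
          generalize θ * Vdot x = b
          generalize V (x + θ) - V x = D
          have h1 : D ^ 2 ≤ 2 * ((D - b) ^ 2 + b ^ 2) := by nlinarith [sq_nonneg (D - b - b)]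
          have h2 := pow_le_pow_left₀ (sq_nonneg D) h1 2
          nlinarith [sq_nonneg ((D - b) ^ 2 - b ^ 2)]
      _ ≤ _ := by
          rw [lintegral_add_left (by fun_prop), lintegral_const_mul _ (by fun_prop),
            lintegral_const_mul _ (by fun_prop), ENNReal.ofReal_add (by positivity) (by positivity),
            ENNReal.ofReal_mul (p := 8) (q := (C * |θ| ^ β) ^ 4) (by norm_num), ← mul_assoc,
            ENNReal.ofReal_mul (p := 8 * |θ| ^ 4) (q := B ^ 4) (by positivity)]
          gcongr
          exact hRn θ 4 (by norm_num) le_rfl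
  refine ⟨16 * B ^ 4, by positivity, fun θ => ?_⟩
  calc _ ≤ ∫⁻ x, (ENNReal.ofReal ((V (x + θ) - V x) ^ 4)
        + ENNReal.ofReal ((V (x + θ) - V x) ^ 4 * Real.exp (-(V (x + θ) - V x)))
        + ENNReal.ofReal (|V (x + θ) - V x - θ * Vdot x| ^ 2)) ∂(piMeasure V) := by
        refine lintegral_mono fun x => ?_
        rw [← ENNReal.ofReal_add (by positivity) (by positivity),
          ← ENNReal.ofReal_add (by positivity) (by positivity)]
        refine ENNReal.ofReal_le_ofReal ?_
        rw [sq_abs]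
        exact aux_pt _ _
    _ ≤ ENNReal.ofReal (8 * (C * |θ| ^ β) ^ 4 + 8 * (|θ| ^ 4 * B ^ 4))
        + ENNReal.ofReal (8 * (C * |θ| ^ β) ^ 4 + 8 * (|θ| ^ 4 * B ^ 4))
        + ENNReal.ofReal ((C * |θ| ^ β) ^ 2) := by
        rw [lintegral_add_left (by fun_prop), lintegral_add_left (by fun_prop), aux_shift V hV]
        have := hD (-θ)
        rw [abs_neg] at this
        gcongr
        · exact hD θ
        · exact hRn θ 2 (by norm_num) (by norm_num)
    _ = _ := by
        rw [← ENNReal.ofReal_add (by positivity) (by positivity),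
          ← ENNReal.ofReal_add (by positivity) (by positivity)]
        congr 1
        rw [Real.rpow_mul (abs_nonneg _), Real.rpow_mul (abs_nonneg _)]
        have e1 : ∀ t : ℝ, t ^ (4 : ℝ) = t ^ 4 := fun t => by exact_mod_cast Real.rpow_natCast t 4
        have e2 : ∀ t : ℝ, t ^ (2 : ℝ) = t ^ 2 := fun t => by exact_mod_cast Real.rpow_natCast t 2
        rw [e1, e1, e2]
        ring

/-- Lemma 6(i): `lim_d d · E[(ζ^d(X,Z) + ℓ Z V̇(X)/(2√d))²] = 0` where `X ∼ π` and
`Z` is an independent standard Gaussian. -/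
theorem stmt_1
    (V Vdot : ℝ → ℝ) (hV : Measurable V) (hVdot : Measurable Vdot)
    (hVint : Integrable (fun y => Real.exp (-V y)))
    (p C β : ℝ) (hp : 4 < p) (hC : 0 < C) (hβ : 1 < β)
    (hH1i : ∀ θ : ℝ,
      Integrable (fun x => |V (x + θ) - V x - θ * Vdot x| ^ p) (piMeasure V) ∧
      (∫ x, |V (x + θ) - V x - θ * Vdot x| ^ p ∂(piMeasure V)) ^ (1 / p) ≤ C * |θ| ^ β)
    (hH1ii : Integrable (fun x => |Vdot x| ^ (6 : ℝ)) (piMeasure V))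
    (ℓ : ℝ) (hℓ : 0 < ℓ) :
    Tendsto (fun d : ℕ =>
      (d : ℝ) * ∫ q : ℝ × ℝ,
        (zeta V ℓ d q.1 q.2 + ℓ * q.2 * Vdot q.1 / (2 * Real.sqrt d)) ^ 2
          ∂((piMeasure V).prod (gaussianReal 0 1)))
      atTop (𝓝 0) := by
  obtain ⟨M, hM, hfix⟩ := aux_fixed V Vdot hV hVdot hVint p C β hp hC hH1i hH1ii
  have := aux_prob V hVint
  have hs4 : 2 < β * 4 := by linarith
  have hs2 : 2 < β * 2 := by linarith
  have hlim := (((aux_gauss_lim (β * 4) ℓ hs4 hℓ).const_mul (16 * C ^ 4)).add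
    ((aux_gauss_lim 4 ℓ (by norm_num) hℓ).const_mul M)).add
    ((aux_gauss_lim (β * 2) ℓ hs2 hℓ).const_mul (C ^ 2))
  simp only [mul_zero, add_zero] at hlim
  refine squeeze_zero (fun d => ?_) (fun d => ?_) hlim
  · exact mul_nonneg (Nat.cast_nonneg _) (integral_nonneg fun _ => sq_nonneg _)
  have hgint : ∀ s : ℝ, 0 < s →
      Integrable (fun z : ℝ => |ℓ * z / Real.sqrt d| ^ s) (gaussianReal 0 1) := by
    intro s hs
    have := aux_gauss_int s (ℓ / Real.sqrt d) hs
    refine this.congr (Eventually.of_forall fun z => ?_)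
    simp only [div_mul_eq_mul_div]
  have i1 := (hgint (β * 4) (by linarith)).const_mul (16 * C ^ 4)
  have i2 := (hgint 4 (by norm_num)).const_mul M
  have i3 := (hgint (β * 2) (by linarith)).const_mul (C ^ 2)
  have i12 : Integrable (fun z : ℝ => 16 * C ^ 4 * |ℓ * z / Real.sqrt d| ^ (β * 4)
      + M * |ℓ * z / Real.sqrt d| ^ (4 : ℝ)) (gaussianReal 0 1) := i1.add i2
  have i123 : Integrable (fun z : ℝ => 16 * C ^ 4 * |ℓ * z / Real.sqrt d| ^ (β * 4)
      + M * |ℓ * z / Real.sqrt d| ^ (4 : ℝ) + C ^ 2 * |ℓ * z / Real.sqrt d| ^ (β * 2))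
      (gaussianReal 0 1) := i12.add i3
  have key : ∫ q : ℝ × ℝ,
        (zeta V ℓ d q.1 q.2 + ℓ * q.2 * Vdot q.1 / (2 * Real.sqrt d)) ^ 2
          ∂((piMeasure V).prod (gaussianReal 0 1))
      ≤ ∫ z, (16 * C ^ 4 * |ℓ * z / Real.sqrt d| ^ (β * 4) + M * |ℓ * z / Real.sqrt d| ^ (4 : ℝ)
          + C ^ 2 * |ℓ * z / Real.sqrt d| ^ (β * 2)) ∂(gaussianReal 0 1) := by
    have hmeas : Measurable (fun q : ℝ × ℝ =>
        (zeta V ℓ d q.1 q.2 + ℓ * q.2 * Vdot q.1 / (2 * Real.sqrt d)) ^ 2) := by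
      unfold zeta; fun_prop
    rw [integral_eq_lintegral_of_nonneg_ae (Eventually.of_forall fun _ => sq_nonneg _)
      hmeas.aestronglyMeasurable]
    refine ENNReal.toReal_le_of_le_ofReal (integral_nonneg fun z => by positivity) ?_
    rw [ofReal_integral_eq_lintegral_ofReal i123
      (Eventually.of_forall fun z => by simp only [Pi.zero_apply]; positivity),
      lintegral_prod_symm _ hmeas.ennreal_ofReal.aemeasurable]
    refine lintegral_mono fun z => ?_
    refine le_trans (le_of_eq ?_) (hfix (ℓ * z / Real.sqrt d))
    refine lintegral_congr fun x => ?_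
    congr 2
    unfold zeta
    rw [neg_sub]
    congr 1
    ring
  rw [integral_add i12 i3, integral_add i1 i2, integral_const_mul, integral_const_mul,
    integral_const_mul] at key
  refine (mul_le_mul_of_nonneg_left key (Nat.cast_nonneg d)).trans (le_of_eq ?_)
  ring
end
end

section
/- Assume H1 and let p > 4 be the exponent from H1(i). Let X be a real random variable with density π and Z an independent standard Gaussian random variable. Then lim_{d→∞} √d · E[|V(X) − V(X + ℓZ/√d) + ℓZ V̇(X)/√d|^p]^{1/p} = 0. -/
open MeasureTheory ProbabilityTheory Filter Real
open scoped ENNReal NNReal Topology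

noncomputable section

/-- Lemma 6(ii): `lim_d √d · E[|V(X) - V(X + ℓZ/√d) + ℓZ V̇(X)/√d|^p]^{1/p} = 0`. -/
theorem stmt_2
    (V Vdot : ℝ → ℝ) (hV : Measurable V) (hVdot : Measurable Vdot)
    (hVint : Integrable (fun y => Real.exp (-V y)))
    (p C β : ℝ) (hp : 4 < p) (hC : 0 < C) (hβ : 1 < β)
    (hH1i : ∀ θ : ℝ,
      Integrable (fun x => |V (x + θ) - V x - θ * Vdot x| ^ p) (piMeasure V) ∧
      (∫ x, |V (x + θ) - V x - θ * Vdot x| ^ p ∂(piMeasure V)) ^ (1 / p) ≤ C * |θ| ^ β)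
    (hH1ii : Integrable (fun x => |Vdot x| ^ (6 : ℝ)) (piMeasure V))
    (ℓ : ℝ) (hℓ : 0 < ℓ) :
    Tendsto (fun d : ℕ =>
      Real.sqrt d * (∫ q : ℝ × ℝ,
        |V q.1 - V (q.1 + ℓ * q.2 / Real.sqrt d) + ℓ * q.2 * Vdot q.1 / Real.sqrt d| ^ p
          ∂((piMeasure V).prod (gaussianReal 0 1))) ^ (1 / p))
      atTop (𝓝 0) := by
  have hp0 : 0 < p := by linarith
  have hM : Integrable (fun z : ℝ => |z| ^ (β * p)) (gaussianReal 0 1) := by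
    have h := memLp_id_gaussianReal (μ := 0) (v := 1) (Real.toNNReal (β * p))
    have h2 := h.integrable_norm_rpow'
    have hbp : 0 ≤ β * p := by positivity
    simpa [Real.norm_eq_abs, hbp] using h2
  haveI : SFinite (piMeasure V) := by unfold piMeasure; infer_instance
  set M : ℝ := ∫ z, |z| ^ (β * p) ∂(gaussianReal 0 1) with hMdef
  have hM0 : 0 ≤ M := integral_nonneg (fun z => by positivity)
  have key : ∀ d : ℕ, 1 ≤ d → (∫ q : ℝ × ℝ,
        |V q.1 - V (q.1 + ℓ * q.2 / Real.sqrt d) + ℓ * q.2 * Vdot q.1 / Real.sqrt d| ^ p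
          ∂((piMeasure V).prod (gaussianReal 0 1))) ≤ (C * (ℓ / √d) ^ β) ^ p * M := by
    intro d hd
    have hs : 0 < √(d : ℝ) := Real.sqrt_pos.2 (by exact_mod_cast hd)
    by_cases hint : Integrable (fun q : ℝ × ℝ =>
        |V q.1 - V (q.1 + ℓ * q.2 / Real.sqrt d) + ℓ * q.2 * Vdot q.1 / Real.sqrt d| ^ p)
          ((piMeasure V).prod (gaussianReal 0 1))
    swap
    · rw [integral_undef hint]; positivity
    rw [integral_prod_symm _ hint, hMdef, ← integral_const_mul]
    apply integral_mono_of_nonneg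
    · exact Eventually.of_forall (fun z => integral_nonneg (fun x => by positivity))
    · exact hM.const_mul _
    refine Eventually.of_forall (fun z => ?_)
    have hb := (hH1i (ℓ * z / √d)).2
    have hI : 0 ≤ ∫ x, |V (x + ℓ * z / √d) - V x - ℓ * z / √d * Vdot x| ^ p ∂(piMeasure V) :=
      integral_nonneg (fun x => by positivity)
    have h3 := Real.rpow_le_rpow (by positivity) hb hp0.le
    rw [← Real.rpow_mul hI, one_div_mul_cancel hp0.ne', Real.rpow_one] at h3
    have e1 : (fun x => |V x - V (x + ℓ * z / √d) + ℓ * z * Vdot x / √d| ^ p)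
        = fun x => |V (x + ℓ * z / √d) - V x - ℓ * z / √d * Vdot x| ^ p := by
      funext x
      rw [← abs_neg]
      congr 2
      ring
    have e2 : (C * |ℓ * z / √d| ^ β) ^ p = (C * (ℓ / √d) ^ β) ^ p * |z| ^ (β * p) := by
      have : |ℓ * z / √d| = (ℓ / √d) * |z| := by
        rw [abs_div, abs_mul, abs_of_pos hℓ, abs_of_pos hs]; ring
      rw [this, Real.mul_rpow (by positivity) (abs_nonneg z), ← mul_assoc,
        Real.mul_rpow (by positivity) (by positivity), ← Real.rpow_mul (abs_nonneg z)]
    simp only [e1]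
    rw [← e2]
    exact h3
  have key2 : ∀ d : ℕ, 1 ≤ d → √(d : ℝ) * (∫ q : ℝ × ℝ,
        |V q.1 - V (q.1 + ℓ * q.2 / Real.sqrt d) + ℓ * q.2 * Vdot q.1 / Real.sqrt d| ^ p
          ∂((piMeasure V).prod (gaussianReal 0 1))) ^ (1 / p)
        ≤ C * ℓ ^ β * M ^ (1 / p) * √(d : ℝ) ^ (-(β - 1)) := by
    intro d hd
    have hs : 0 < √(d : ℝ) := Real.sqrt_pos.2 (by exact_mod_cast hd)
    have h := Real.rpow_le_rpow (integral_nonneg (fun x => by positivity)) (key d hd)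
      (by positivity : 0 ≤ 1 / p)
    rw [Real.mul_rpow (by positivity) hM0, ← Real.rpow_mul (by positivity),
      mul_one_div_cancel hp0.ne', Real.rpow_one, Real.div_rpow hℓ.le hs.le] at h
    refine (mul_le_mul_of_nonneg_left h hs.le).trans (le_of_eq ?_)
    rw [neg_sub, Real.rpow_sub hs, Real.rpow_one]
    ring
  have hlim : Tendsto (fun d : ℕ => C * ℓ ^ β * M ^ (1 / p) * √(d : ℝ) ^ (-(β - 1)))
      atTop (𝓝 0) := by
    have h1 : Tendsto (fun d : ℕ => √(d : ℝ)) atTop atTop :=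
      Real.tendsto_sqrt_atTop.comp tendsto_natCast_atTop_atTop
    have h2 := (tendsto_rpow_neg_atTop (by linarith : 0 < β - 1)).comp h1
    simpa using h2.const_mul (C * ℓ ^ β * M ^ (1 / p))
  refine squeeze_zero' (Eventually.of_forall fun d => ?_) ?_ hlim
  · exact mul_nonneg (Real.sqrt_nonneg _)
      (Real.rpow_nonneg (integral_nonneg (fun x => by positivity)) _)
  · filter_upwards [eventually_ge_atTop 1] with d hd using key2 d hd
end
end

section
/- Assume H1. Let X be a real random variable with density π and Z an independent standard Gaussian random variable. Then lim_{d→∞} 2d · E[ζ^d(X,Z)] = −ℓ² I / 4, where I = ∫ V̇(x)² π(x) dx. -/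
open MeasureTheory ProbabilityTheory Filter Real
open scoped ENNReal NNReal Topology

noncomputable section

lemma h_piDen_meas (V : ℝ → ℝ) (hV : Measurable V) : Measurable (piDen V) := by
  unfold piDen; fun_prop

lemma h_lint (V : ℝ → ℝ) (hV : Measurable V) (f : ℝ → ℝ≥0∞) (hf : Measurable f) :
    ∫⁻ x, f x ∂(piMeasure V) = ∫⁻ x, ENNReal.ofReal (piDen V x) * f x := by
  unfold piMeasure
  rw [lintegral_withDensity_eq_lintegral_mul _ (h_piDen_meas V hV).ennreal_ofReal hf]
  rfl

lemma h_prob (V : ℝ → ℝ) (hV : Measurable V) (hVint : Integrable (fun y => Real.exp (-V y))) :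
    IsProbabilityMeasure (piMeasure V) := by
  have hpos : 0 < ∫ y : ℝ, Real.exp (-V y) := integral_exp_pos hVint
  constructor
  have h1 := h_lint V hV (fun _ => 1) measurable_const
  simp only [lintegral_one, mul_one] at h1
  rw [h1, ← ofReal_integral_eq_lintegral_ofReal]
  · unfold piDen
    rw [integral_div, div_self hpos.ne', ENNReal.ofReal_one]
  · exact hVint.div_const _
  · exact Eventually.of_forall fun x => by unfold piDen; positivity

/-- Change of variables. -/
lemma h_shift (V : ℝ → ℝ) (hV : Measurable V)
    (f : ℝ → ℝ≥0∞) (hf : Measurable f) (θ : ℝ) :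
    ∫⁻ x, f (x + θ) * ENNReal.ofReal (Real.exp (V x - V (x + θ))) ∂(piMeasure V)
      = ∫⁻ x, f x ∂(piMeasure V) := by
  rw [h_lint V hV _ (by fun_prop), h_lint V hV _ hf,
    ← lintegral_add_right_eq_self (fun x => ENNReal.ofReal (piDen V x) * f x) θ]
  refine lintegral_congr fun x => ?_
  rw [mul_comm (f (x + θ)), ← mul_assoc, ← ENNReal.ofReal_mul]
  · congr 2
    unfold piDen
    rw [div_mul_eq_mul_div, ← Real.exp_add]
    congr 2
    ring
  · unfold piDen
    have : 0 ≤ ∫ y : ℝ, Real.exp (-V y) := integral_nonneg fun _ => (Real.exp_pos _).le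
    positivity

lemma h_exp (t : ℝ) : (Real.exp t - 1 - t) ^ 2 ≤ t ^ 4 * (1 + Real.exp (2 * t)) := by
  have h2 : Real.exp (2 * t) = Real.exp t ^ 2 := by rw [← Real.exp_nat_mul]; norm_num
  have h0 : 0 ≤ Real.exp t - 1 - t := by linarith [Real.add_one_le_exp t]
  have hp := Real.exp_pos t
  rw [h2]
  rcases le_or_gt t 0 with ht | ht
  · have : Real.exp t - 1 - t ≤ t ^ 2 := by
      rcases le_or_gt (-1) t with h | h
      · exact (le_abs_self _).trans (Real.abs_exp_sub_one_sub_id_le (abs_le.2 ⟨h, by linarith⟩))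
      · have : Real.exp t ≤ 1 := Real.exp_le_one_iff.2 ht
        nlinarith
    have := pow_le_pow_left₀ h0 this 2
    have h3 : 0 ≤ t ^ 4 * Real.exp t ^ 2 := by positivity
    nlinarith
  · have h1 : Real.exp t - 1 ≤ t * Real.exp t := by
      have := Real.add_one_le_exp (-t)
      have h4 : Real.exp (-t) * Real.exp t = 1 := by rw [← Real.exp_add]; simp
      nlinarith
    have : Real.exp t - 1 - t ≤ t ^ 2 * Real.exp t := by nlinarith
    have := pow_le_pow_left₀ h0 this 2
    have h3 : 0 ≤ t ^ 4 := by positivity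
    nlinarith

lemma h_Wint (V : ℝ → ℝ) (hV : Measurable V) (hVint : Integrable (fun y => Real.exp (-V y)))
    (θ : ℝ) :
    Integrable (fun x => Real.exp (V x - V (x + θ))) (piMeasure V) ∧
    ∫ x, Real.exp (V x - V (x + θ)) ∂(piMeasure V) = 1 := by
  have := h_prob V hV hVint
  have h := h_shift V hV (fun _ => 1) measurable_const θ
  simp only [one_mul, lintegral_one, measure_univ] at h
  have hm : Measurable (fun x => Real.exp (V x - V (x + θ))) := by fun_prop
  have hn : 0 ≤ᵐ[piMeasure V] (fun x => Real.exp (V x - V (x + θ))) :=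
    Eventually.of_forall fun x => (Real.exp_pos _).le
  constructor
  · refine ⟨hm.aestronglyMeasurable, ?_⟩
    rw [hasFiniteIntegral_iff_ofReal hn, h]
    simp
  · rw [integral_eq_lintegral_of_nonneg_ae hn hm.aestronglyMeasurable, h]
    simp

/-- The increment at fixed `θ`. -/
def hW (V : ℝ → ℝ) (θ x : ℝ) : ℝ := Real.exp ((V x - V (x + θ)) / 2) - 1

lemma h_W_meas (V : ℝ → ℝ) (hV : Measurable V) (θ : ℝ) : Measurable (hW V θ) := by
  unfold hW; fun_prop

lemma h_W_sq (V : ℝ → ℝ) (θ x : ℝ) :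
    hW V θ x ^ 2 = Real.exp (V x - V (x + θ)) - 1 - 2 * hW V θ x := by
  unfold hW
  have : Real.exp (V x - V (x + θ)) = Real.exp ((V x - V (x + θ)) / 2) ^ 2 := by
    rw [← Real.exp_nat_mul]; congr 1; push_cast; ring
  rw [this]; ring

lemma h_W_abs (V : ℝ → ℝ) (θ x : ℝ) :
    |hW V θ x| ≤ Real.exp (V x - V (x + θ)) + 1 := by
  have h := h_W_sq V θ x
  have h1 : -1 ≤ hW V θ x := by unfold hW; linarith [Real.exp_pos ((V x - V (x + θ)) / 2)]
  have h2 := Real.exp_pos (V x - V (x + θ))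
  rw [abs_le]
  constructor
  · linarith
  · nlinarith

lemma h_W_memLp (V : ℝ → ℝ) (hV : Measurable V) (hVint : Integrable (fun y => Real.exp (-V y)))
    (θ : ℝ) : Integrable (hW V θ) (piMeasure V) ∧ MemLp (hW V θ) 2 (piMeasure V) ∧
      ∫ x, hW V θ x ∂(piMeasure V) = - (∫ x, hW V θ x ^ 2 ∂(piMeasure V)) / 2 := by
  have := h_prob V hV hVint
  obtain ⟨hi, he⟩ := h_Wint V hV hVint θ
  have hm := h_W_meas V hV θ
  have h1 : Integrable (hW V θ) (piMeasure V) := by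
    refine Integrable.mono' (hi.add (integrable_const 1)) hm.aestronglyMeasurable ?_
    exact Eventually.of_forall fun x => h_W_abs V θ x
  refine ⟨h1, ?_, ?_⟩
  · rw [memLp_two_iff_integrable_sq hm.aestronglyMeasurable]
    simp only [h_W_sq]
    exact (hi.sub (integrable_const 1)).sub (h1.const_mul 2)
  · simp only [h_W_sq]
    have hi' : Integrable (fun x => Real.exp (V x - V (x + θ)) - 1) (piMeasure V) :=
      hi.sub (integrable_const 1)
    rw [integral_sub hi' (h1.const_mul 2),
      integral_sub hi (integrable_const 1), he, integral_const_mul]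
    simp

lemma h_R (V Vdot : ℝ → ℝ) (hV : Measurable V) (hVdot : Measurable Vdot)
    (hVint : Integrable (fun y => Real.exp (-V y)))
    (p C β : ℝ) (hp : 4 < p)
    (hH1i : ∀ θ : ℝ,
      Integrable (fun x => |V (x + θ) - V x - θ * Vdot x| ^ p) (piMeasure V) ∧
      (∫ x, |V (x + θ) - V x - θ * Vdot x| ^ p ∂(piMeasure V)) ^ (1 / p) ≤ C * |θ| ^ β)
    (θ : ℝ) :
    eLpNorm (fun x => V (x + θ) - V x - θ * Vdot x) 4 (piMeasure V)
      ≤ ENNReal.ofReal (C * |θ| ^ β) := by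
  have := h_prob V hV hVint
  have hm : Measurable (fun x => V (x + θ) - V x - θ * Vdot x) := by fun_prop
  obtain ⟨h1, h2⟩ := hH1i θ
  have hp0 : ENNReal.ofReal p ≠ 0 := by
    rw [Ne, ENNReal.ofReal_eq_zero]; linarith
  have hpr : (ENNReal.ofReal p).toReal = p := ENNReal.toReal_ofReal (by linarith)
  have hmem : MemLp (fun x => V (x + θ) - V x - θ * Vdot x) (ENNReal.ofReal p) (piMeasure V) := by
    rw [← integrable_norm_rpow_iff hm.aestronglyMeasurable hp0 ENNReal.ofReal_ne_top, hpr]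
    exact h1
  refine (eLpNorm_le_eLpNorm_of_exponent_le (q := ENNReal.ofReal p) ?_
    hm.aestronglyMeasurable).trans ?_
  · have : (4 : ℝ≥0∞) = ENNReal.ofReal 4 := by simp
    rw [this]
    exact ENNReal.ofReal_le_ofReal hp.le
  · rw [hmem.eLpNorm_eq_integral_rpow_norm hp0 ENNReal.ofReal_ne_top, hpr]
    refine ENNReal.ofReal_le_ofReal ?_
    rw [← one_div]
    exact h2

lemma h_Vdot (V Vdot : ℝ → ℝ) (hVdot : Measurable Vdot)
    [IsProbabilityMeasure (piMeasure V)]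
    (hH1ii : Integrable (fun x => |Vdot x| ^ (6 : ℝ)) (piMeasure V)) :
    MemLp Vdot 4 (piMeasure V) := by
  have : MemLp Vdot 6 (piMeasure V) := by
    rw [← integrable_norm_rpow_iff hVdot.aestronglyMeasurable (by norm_num) (by norm_num)]
    simpa using hH1ii
  exact this.mono_exponent (by norm_num)

lemma h_u (V Vdot : ℝ → ℝ) (hV : Measurable V) (hVdot : Measurable Vdot)
    (hVint : Integrable (fun y => Real.exp (-V y)))
    (p C β : ℝ) (hp : 4 < p) (hC : 0 < C) (hβ : 1 < β)
    (hH1i : ∀ θ : ℝ,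
      Integrable (fun x => |V (x + θ) - V x - θ * Vdot x| ^ p) (piMeasure V) ∧
      (∫ x, |V (x + θ) - V x - θ * Vdot x| ^ p ∂(piMeasure V)) ^ (1 / p) ≤ C * |θ| ^ β)
    (hH1ii : Integrable (fun x => |Vdot x| ^ (6 : ℝ)) (piMeasure V)) :
    ∃ K : ℝ, 0 ≤ K ∧ ∀ θ : ℝ, |θ| ≤ 1 →
      ∫⁻ x, ENNReal.ofReal ((V (x + θ) - V x) ^ 4) ∂(piMeasure V)
        ≤ ENNReal.ofReal (K * θ ^ 4) := by
  have := h_prob V hV hVint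
  have hmem := h_Vdot V Vdot hVdot hH1ii
  set N := (eLpNorm Vdot 4 (piMeasure V)).toReal with hN
  have hN0 : 0 ≤ N := ENNReal.toReal_nonneg
  have hNe : eLpNorm Vdot 4 (piMeasure V) = ENNReal.ofReal N :=
    (ENNReal.ofReal_toReal hmem.eLpNorm_ne_top).symm
  refine ⟨(C + N) ^ 4, by positivity, fun θ hθ => ?_⟩
  have h1 : eLpNorm (fun x => V (x + θ) - V x) 4 (piMeasure V)
      ≤ ENNReal.ofReal ((C + N) * |θ|) := by
    have hsplit : (fun x => V (x + θ) - V x)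
        = (fun x => V (x + θ) - V x - θ * Vdot x) + θ • Vdot := by
      ext x; simp
    rw [hsplit]
    refine (eLpNorm_add_le (by fun_prop) (by fun_prop) (by norm_num)).trans ?_
    rw [eLpNorm_const_smul, hNe, Real.enorm_eq_ofReal_abs, ← ENNReal.ofReal_mul (abs_nonneg _)]
    refine (add_le_add_left (h_R V Vdot hV hVdot hVint p C β hp hH1i θ) _).trans ?_
    rw [← ENNReal.ofReal_add (by positivity) (by positivity)]
    refine ENNReal.ofReal_le_ofReal ?_
    have : |θ| ^ β ≤ |θ| := by
      have := Real.rpow_le_rpow_of_exponent_ge' (abs_nonneg θ) hθ zero_le_one hβ.le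
      simpa using this
    nlinarith
  have h2 : ∫⁻ x, ENNReal.ofReal ((V (x + θ) - V x) ^ 4) ∂(piMeasure V)
      = eLpNorm (fun x => V (x + θ) - V x) 4 (piMeasure V) ^ 4 := by
    have := eLpNorm_nnreal_pow_eq_lintegral (μ := piMeasure V)
      (f := fun x => V (x + θ) - V x) (p := 4) (by norm_num)
    have h4 : ((4 : ℝ≥0) : ℝ) = ((4 : ℕ) : ℝ) := by norm_num
    simp only [h4, ENNReal.rpow_natCast] at this
    have h5 : ((4 : ℝ≥0) : ℝ≥0∞) = 4 := by norm_num
    rw [h5] at this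
    rw [this]
    refine lintegral_congr fun x => ?_
    rw [Real.enorm_eq_ofReal_abs, ← ENNReal.ofReal_pow (abs_nonneg _)]
    congr 1
    exact (Even.pow_abs (by decide) _).symm
  rw [h2]
  refine (pow_le_pow_left' h1 4).trans ?_
  rw [← ENNReal.ofReal_pow (by positivity)]
  refine ENNReal.ofReal_le_ofReal (le_of_eq ?_)
  rw [mul_pow, Even.pow_abs (by decide)]

lemma h_main (V Vdot : ℝ → ℝ) (hV : Measurable V) (hVdot : Measurable Vdot)
    (hVint : Integrable (fun y => Real.exp (-V y)))
    (p C β : ℝ) (hp : 4 < p) (hC : 0 < C) (hβ : 1 < β)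
    (hH1i : ∀ θ : ℝ,
      Integrable (fun x => |V (x + θ) - V x - θ * Vdot x| ^ p) (piMeasure V) ∧
      (∫ x, |V (x + θ) - V x - θ * Vdot x| ^ p ∂(piMeasure V)) ^ (1 / p) ≤ C * |θ| ^ β)
    (hH1ii : Integrable (fun x => |Vdot x| ^ (6 : ℝ)) (piMeasure V)) :
    ∃ K : ℝ, 0 ≤ K ∧ ∀ θ : ℝ, |θ| ≤ 1 →
      eLpNorm (hW V θ + (θ / 2) • Vdot) 2 (piMeasure V)
        ≤ ENNReal.ofReal (K * θ ^ 2 + C * |θ| ^ β) := by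
  have := h_prob V hV hVint
  obtain ⟨K, hK, hu⟩ := h_u V Vdot hV hVdot hVint p C β hp hC hβ hH1i hH1ii
  refine ⟨√(2 * K), by positivity, fun θ hθ => ?_⟩
  have hWm := h_W_meas V hV θ
  have hr : eLpNorm (fun x => hW V θ x + (V (x + θ) - V x) / 2) 2 (piMeasure V)
      ≤ ENNReal.ofReal (√(2 * K) * θ ^ 2) := by
    have h2 : eLpNorm (fun x => hW V θ x + (V (x + θ) - V x) / 2) 2 (piMeasure V) ^ 2
        = ∫⁻ x, ENNReal.ofReal ((hW V θ x + (V (x + θ) - V x) / 2) ^ 2) ∂(piMeasure V) := by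
      have := eLpNorm_nnreal_pow_eq_lintegral (μ := piMeasure V)
        (f := fun x => hW V θ x + (V (x + θ) - V x) / 2) (p := 2) (by norm_num)
      have h4 : ((2 : ℝ≥0) : ℝ) = ((2 : ℕ) : ℝ) := by norm_num
      simp only [h4, ENNReal.rpow_natCast] at this
      have h5 : ((2 : ℝ≥0) : ℝ≥0∞) = 2 := by norm_num
      rw [h5] at this
      rw [this]
      refine lintegral_congr fun x => ?_
      rw [Real.enorm_eq_ofReal_abs, ← ENNReal.ofReal_pow (abs_nonneg _), sq_abs]
    have h3 : ∫⁻ x, ENNReal.ofReal ((hW V θ x + (V (x + θ) - V x) / 2) ^ 2) ∂(piMeasure V)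
        ≤ ENNReal.ofReal (2 * K * θ ^ 4) := by
      calc _ ≤ ∫⁻ x, (ENNReal.ofReal ((V (x + θ) - V x) ^ 4)
              + ENNReal.ofReal ((V ((x + θ) + (-θ)) - V (x + θ)) ^ 4)
                * ENNReal.ofReal (Real.exp (V x - V (x + θ)))) ∂(piMeasure V) := by
            refine lintegral_mono fun x => ?_
            rw [← ENNReal.ofReal_mul (by positivity),
              ← ENNReal.ofReal_add (by positivity) (by positivity)]
            refine ENNReal.ofReal_le_ofReal ?_
            have h := h_exp ((V x - V (x + θ)) / 2)
            rw [mul_div_cancel₀ _ (two_ne_zero)] at h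
            rw [add_neg_cancel_right]
            unfold hW
            have e := Real.exp_pos (V x - V (x + θ))
            have h6 : 0 ≤ (V x - V (x + θ)) ^ 4 := by positivity
            have h7 : 0 ≤ (V x - V (x + θ)) ^ 4 * Real.exp (V x - V (x + θ)) := by positivity
            have h8 : (V (x + θ) - V x) ^ 4 = (V x - V (x + θ)) ^ 4 := by ring
            rw [h8]
            calc _ = (Real.exp ((V x - V (x + θ)) / 2) - 1 - (V x - V (x + θ)) / 2) ^ 2 := by ring
              _ ≤ _ := h
              _ = ((V x - V (x + θ)) ^ 4
                  + (V x - V (x + θ)) ^ 4 * Real.exp (V x - V (x + θ))) / 16 := by ring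
              _ ≤ _ := by linarith
        _ = ∫⁻ x, ENNReal.ofReal ((V (x + θ) - V x) ^ 4) ∂(piMeasure V)
            + ∫⁻ x, ENNReal.ofReal ((V (x + (-θ)) - V x) ^ 4) ∂(piMeasure V) := by
            rw [lintegral_add_left (by fun_prop)]
            congr 1
            exact h_shift V hV (fun y => ENNReal.ofReal ((V (y + (-θ)) - V y) ^ 4))
              (by fun_prop) θ
        _ ≤ ENNReal.ofReal (K * θ ^ 4) + ENNReal.ofReal (K * (-θ) ^ 4) :=
            add_le_add (hu θ hθ) (hu (-θ) (by rwa [abs_neg]))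
        _ = _ := by
            rw [← ENNReal.ofReal_add (by positivity) (by positivity)]
            congr 1; ring
    rw [← h2] at h3
    have h4 : ENNReal.ofReal (2 * K * θ ^ 4) = ENNReal.ofReal (√(2 * K) * θ ^ 2) ^ 2 := by
      rw [← ENNReal.ofReal_pow (by positivity), mul_pow, Real.sq_sqrt (by positivity)]
      congr 1; ring
    rw [h4] at h3
    exact (ENNReal.pow_le_pow_left_iff two_ne_zero).1 h3
  have hsplit : hW V θ + (θ / 2) • Vdot = (fun x => hW V θ x + (V (x + θ) - V x) / 2)
      + (-(1/2) : ℝ) • (fun x => V (x + θ) - V x - θ * Vdot x) := by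
    ext x; simp; ring
  rw [hsplit]
  refine (eLpNorm_add_le (by fun_prop) (by fun_prop) (by norm_num)).trans ?_
  rw [ENNReal.ofReal_add (by positivity) (by positivity)]
  refine add_le_add hr ?_
  rw [eLpNorm_const_smul]
  have hm : Measurable (fun x => V (x + θ) - V x - θ * Vdot x) := by fun_prop
  have h9 := (eLpNorm_le_eLpNorm_of_exponent_le (p := 2) (q := 4) (by norm_num)
    (hm.aestronglyMeasurable (μ := piMeasure V))).trans
    (h_R V Vdot hV hVdot hVint p C β hp hH1i θ)
  refine le_trans ?_ h9
  have : ‖(-(1/2) : ℝ)‖ₑ ≤ 1 := by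
    rw [Real.enorm_eq_ofReal_abs, ENNReal.ofReal_le_one]; norm_num [abs_of_pos]
  exact mul_le_of_le_one_left' this

lemma h_norm_sq {μ : Measure ℝ} {f : ℝ → ℝ} (hf : MemLp f 2 μ) :
    (eLpNorm f 2 μ).toReal ^ 2 = ∫ x, f x ^ 2 ∂μ := by
  rw [hf.eLpNorm_eq_integral_rpow_norm (by norm_num) (by norm_num)]
  have h0 : 0 ≤ ∫ x, f x ^ 2 ∂μ := integral_nonneg fun x => sq_nonneg _
  have : (∫ x, ‖f x‖ ^ (2 : ℝ≥0∞).toReal ∂μ) = ∫ x, f x ^ 2 ∂μ := by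
    refine integral_congr_ae (Eventually.of_forall fun x => ?_)
    simp
  rw [this, ENNReal.toReal_ofReal (by positivity)]
  rw [← Real.rpow_natCast, ← Real.rpow_mul h0]
  simp

lemma h_tri {μ : Measure ℝ} {f g : ℝ → ℝ} (hf : MemLp f 2 μ) (hg : MemLp g 2 μ) :
    |(eLpNorm f 2 μ).toReal - (eLpNorm g 2 μ).toReal| ≤ (eLpNorm (f + g) 2 μ).toReal := by
  have hs := hf.add hg
  have h1 : (eLpNorm f 2 μ).toReal ≤ (eLpNorm (f + g) 2 μ).toReal + (eLpNorm g 2 μ).toReal := by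
    rw [← ENNReal.toReal_add hs.eLpNorm_ne_top hg.eLpNorm_ne_top]
    refine ENNReal.toReal_mono (ENNReal.add_ne_top.2 ⟨hs.eLpNorm_ne_top, hg.eLpNorm_ne_top⟩) ?_
    have := eLpNorm_sub_le hs.1 hg.1 (p := 2) (by norm_num)
    simpa using this
  have h2 : (eLpNorm g 2 μ).toReal ≤ (eLpNorm (f + g) 2 μ).toReal + (eLpNorm f 2 μ).toReal := by
    rw [← ENNReal.toReal_add hs.eLpNorm_ne_top hf.eLpNorm_ne_top]
    refine ENNReal.toReal_mono (ENNReal.add_ne_top.2 ⟨hs.eLpNorm_ne_top, hf.eLpNorm_ne_top⟩) ?_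
    have := eLpNorm_sub_le hs.1 hf.1 (p := 2) (by norm_num)
    simpa using this
  rw [abs_le]; constructor <;> linarith

/-- Key asymptotics: `h(θ) = ∫ W_θ²`. -/
lemma h_key (V Vdot : ℝ → ℝ) (hV : Measurable V) (hVdot : Measurable Vdot)
    (hVint : Integrable (fun y => Real.exp (-V y)))
    (p C β : ℝ) (hp : 4 < p) (hC : 0 < C) (hβ : 1 < β)
    (hH1i : ∀ θ : ℝ,
      Integrable (fun x => |V (x + θ) - V x - θ * Vdot x| ^ p) (piMeasure V) ∧
      (∫ x, |V (x + θ) - V x - θ * Vdot x| ^ p ∂(piMeasure V)) ^ (1 / p) ≤ C * |θ| ^ β)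
    (hH1ii : Integrable (fun x => |Vdot x| ^ (6 : ℝ)) (piMeasure V)) :
    (∃ K : ℝ, ∀ θ : ℝ, |∫ x, hW V θ x ∂(piMeasure V)| ≤ K * θ ^ 2) ∧
    Tendsto (fun θ : ℝ => (∫ x, hW V θ x ∂(piMeasure V)) / θ ^ 2) (𝓝[≠] 0)
      (𝓝 (- (∫ x, Vdot x ^ 2 ∂(piMeasure V)) / 8)) := by
  have := h_prob V hV hVint
  obtain ⟨K, hK, hmain⟩ := h_main V Vdot hV hVdot hVint p C β hp hC hβ hH1i hH1ii
  have hVm : MemLp Vdot 2 (piMeasure V) := (h_Vdot V Vdot hVdot hH1ii).mono_exponent (by norm_num)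
  set N := (eLpNorm Vdot 2 (piMeasure V)).toReal with hN
  have hN0 : 0 ≤ N := ENNReal.toReal_nonneg
  set n : ℝ → ℝ := fun θ => (eLpNorm (hW V θ) 2 (piMeasure V)).toReal with hn
  have hn0 : ∀ θ, 0 ≤ n θ := fun θ => ENNReal.toReal_nonneg
  have hg : ∀ θ, ∫ x, hW V θ x ∂(piMeasure V) = - n θ ^ 2 / 2 := fun θ => by
    obtain ⟨_, h2, h3⟩ := h_W_memLp V hV hVint θ
    rw [h3, hn]; simp only; rw [h_norm_sq h2]
  have hdiff : ∀ θ, |θ| ≤ 1 → |n θ - |θ| / 2 * N| ≤ K * θ ^ 2 + C * |θ| ^ β := fun θ hθ => by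
    obtain ⟨_, h2, _⟩ := h_W_memLp V hV hVint θ
    have h := h_tri h2 (hVm.const_smul (θ / 2))
    rw [eLpNorm_const_smul, ENNReal.toReal_mul, toReal_enorm, Real.norm_eq_abs, abs_div,
      abs_two] at h
    refine h.trans ?_
    exact ENNReal.toReal_le_of_le_ofReal (by positivity) (hmain θ hθ)
  constructor
  · refine ⟨(N + K + C) ^ 2 + 1, fun θ => ?_⟩
    rw [hg, abs_div, abs_neg, abs_two, abs_of_nonneg (sq_nonneg _)]
    rcases le_or_gt |θ| 1 with h | h
    · have h1 : |θ| ^ β ≤ |θ| := by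
        have := Real.rpow_le_rpow_of_exponent_ge' (abs_nonneg θ) h zero_le_one hβ.le
        simpa using this
      have h2 : θ ^ 2 ≤ |θ| := by rw [← sq_abs]; nlinarith [abs_nonneg θ]
      have h3 := (abs_le.1 (hdiff θ h)).2
      have h4 : n θ ≤ (N + K + C) * |θ| := by
        have := mul_le_mul_of_nonneg_left h1 hC.le
        have := mul_le_mul_of_nonneg_left h2 hK
        have := mul_nonneg hN0 (abs_nonneg θ)
        nlinarith
      have h5 := pow_le_pow_left₀ (hn0 θ) h4 2
      rw [mul_pow, sq_abs] at h5
      nlinarith [sq_nonneg θ, sq_nonneg (n θ)]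
    · have h1 : -1 ≤ ∫ x, hW V θ x ∂(piMeasure V) := by
        have : ∫ x, (-1 : ℝ) ∂(piMeasure V) ≤ ∫ x, hW V θ x ∂(piMeasure V) := by
          refine integral_mono (integrable_const _) (h_W_memLp V hV hVint θ).1 fun x => ?_
          simp only [hW]
          linarith [Real.exp_pos ((V x - V (x + θ)) / 2)]
        simpa using this
      rw [hg] at h1
      have h2 : 1 ≤ θ ^ 2 := by rw [← sq_abs]; nlinarith
      nlinarith [sq_nonneg (N + K + C)]
  · have h1 : Tendsto (fun θ : ℝ => n θ / |θ|) (𝓝[≠] 0) (𝓝 (N / 2)) := by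
      rw [tendsto_iff_norm_sub_tendsto_zero]
      have hlim : Tendsto (fun θ : ℝ => K * |θ| + C * |θ| ^ (β - 1)) (𝓝[≠] 0) (𝓝 0) := by
        have hc : Continuous (fun θ : ℝ => K * |θ| + C * |θ| ^ (β - 1)) := by
          have : Continuous (fun θ : ℝ => |θ| ^ (β - 1)) :=
            continuous_abs.rpow_const fun _ => Or.inr (by linarith)
          fun_prop
        have := hc.tendsto 0
        rw [abs_zero, Real.zero_rpow (by linarith)] at this
        simp only [mul_zero, add_zero] at this
        exact this.mono_left nhdsWithin_le_nhds
      refine squeeze_zero' (Eventually.of_forall fun _ => norm_nonneg _) ?_ hlim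
      have hev : ∀ᶠ θ : ℝ in 𝓝[≠] 0, |θ| ≤ 1 := by
        refine nhdsWithin_le_nhds ?_
        have : Tendsto (fun θ : ℝ => |θ|) (𝓝 0) (𝓝 0) := by
          simpa using (continuous_abs (G := ℝ)).tendsto 0
        exact (this.eventually (gt_mem_nhds one_pos)).mono fun _ h => h.le
      filter_upwards [hev, self_mem_nhdsWithin] with θ hθ hne
      have hpos : 0 < |θ| := abs_pos.2 hne
      have e1 : n θ / |θ| - N / 2 = (n θ - |θ| / 2 * N) / |θ| := by
        field_simp
      rw [e1, Real.norm_eq_abs, abs_div, abs_abs, div_le_iff₀ hpos]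
      refine (hdiff θ hθ).trans (le_of_eq ?_)
      rw [add_mul, mul_assoc, mul_assoc, ← Real.rpow_add_one hpos.ne', sub_add_cancel, ← sq,
        sq_abs]
    have h2 := ((h1.pow 2).neg).div_const 2
    refine (h2.congr fun θ => ?_).trans_eq ?_
    · rw [hg, div_pow, sq_abs]; ring
    · rw [← h_norm_sq hVm, ← hN]; congr 1; ring

/-- Lemma 4: `lim_d 2d · E[ζ^d(X,Z)] = -ℓ² I / 4` with `I = ∫ V̇² π`. -/
theorem stmt_4
    (V Vdot : ℝ → ℝ) (hV : Measurable V) (hVdot : Measurable Vdot)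
    (hVint : Integrable (fun y => Real.exp (-V y)))
    (p C β : ℝ) (hp : 4 < p) (hC : 0 < C) (hβ : 1 < β)
    (hH1i : ∀ θ : ℝ,
      Integrable (fun x => |V (x + θ) - V x - θ * Vdot x| ^ p) (piMeasure V) ∧
      (∫ x, |V (x + θ) - V x - θ * Vdot x| ^ p ∂(piMeasure V)) ^ (1 / p) ≤ C * |θ| ^ β)
    (hH1ii : Integrable (fun x => |Vdot x| ^ (6 : ℝ)) (piMeasure V))
    (ℓ : ℝ) (hℓ : 0 < ℓ) :
    Tendsto (fun d : ℕ =>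
      2 * (d : ℝ) * ∫ q : ℝ × ℝ,
        zeta V ℓ d q.1 q.2 ∂((piMeasure V).prod (gaussianReal 0 1)))
      atTop (𝓝 (-(ℓ ^ 2 * (∫ x, (Vdot x) ^ 2 ∂(piMeasure V))) / 4)) := by
  have := h_prob V hV hVint
  obtain ⟨⟨K, hK⟩, hlim⟩ := h_key V Vdot hV hVdot hVint p C β hp hC hβ hH1i hH1ii
  set I := ∫ x, (Vdot x) ^ 2 ∂(piMeasure V) with hI
  set g : ℝ → ℝ := fun θ => ∫ x, hW V θ x ∂(piMeasure V) with hgdef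
  have hzm : ∀ d : ℕ, Measurable (fun q : ℝ × ℝ => zeta V ℓ d q.1 q.2) := fun d => by
    unfold zeta; fun_prop
  have hz : ∀ (d : ℕ) (x z : ℝ), zeta V ℓ d x z = hW V (ℓ * z / √d) x := fun d x z => rfl
  have hgm : ∀ d : ℕ, StronglyMeasurable (fun z => g (ℓ * z / √d)) := fun d =>
    StronglyMeasurable.integral_prod_left (μ := piMeasure V)
      (f := fun x z => zeta V ℓ d x z) (hzm d).stronglyMeasurable
  have hfub : ∀ d : ℕ, ∫ q : ℝ × ℝ, zeta V ℓ d q.1 q.2 ∂((piMeasure V).prod (gaussianReal 0 1))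
      = ∫ z, g (ℓ * z / √d) ∂(gaussianReal 0 1) := fun d => by
    refine integral_prod_symm _ ?_
    rw [integrable_prod_iff' (hzm d).aestronglyMeasurable]
    refine ⟨Eventually.of_forall fun z => (h_W_memLp V hV hVint (ℓ * z / √d)).1, ?_⟩
    refine Integrable.mono' (integrable_const (2 : ℝ)) ?_ (Eventually.of_forall fun z => ?_)
    · exact (StronglyMeasurable.integral_prod_left (μ := piMeasure V)
        (f := fun x z => ‖zeta V ℓ d x z‖)
        (hzm d).norm.stronglyMeasurable).aestronglyMeasurable
    · rw [Real.norm_of_nonneg (integral_nonneg fun _ => norm_nonneg _)]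
      obtain ⟨hi, he⟩ := h_Wint V hV hVint (ℓ * z / √d)
      calc _ ≤ ∫ x, (Real.exp (V x - V (x + ℓ * z / √d)) + 1) ∂(piMeasure V) :=
            integral_mono (h_W_memLp V hV hVint (ℓ * z / √d)).1.norm
              (hi.add (integrable_const 1)) fun x => h_W_abs V _ x
        _ = 2 := by
            rw [integral_add hi (integrable_const 1), he]
            simp; norm_num
  have hsq : Integrable (fun z : ℝ => z ^ 2) (gaussianReal 0 1) :=
    (memLp_id_gaussianReal (μ := 0) (v := 1) 2).integrable_sq
  have hvar : ∫ z : ℝ, z ^ 2 ∂(gaussianReal 0 1) = 1 := by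
    have h := variance_id_gaussianReal (μ := 0) (v := 1)
    rw [variance_of_integral_eq_zero aemeasurable_id (by simp)] at h
    simpa using h
  have hgoal : Tendsto (fun d : ℕ => ∫ z, 2 * (d : ℝ) * g (ℓ * z / √d) ∂(gaussianReal 0 1)) atTop
      (𝓝 (∫ z, -(ℓ ^ 2 * I) / 4 * z ^ 2 ∂(gaussianReal 0 1))) := by
    refine tendsto_integral_filter_of_dominated_convergence
      (fun z => 2 * K * ℓ ^ 2 * z ^ 2) ?_ ?_ (hsq.const_mul _) ?_
    · exact Eventually.of_forall fun d => ((hgm d).const_mul _).aestronglyMeasurable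
    · filter_upwards [eventually_gt_atTop 0] with d hd
      refine Eventually.of_forall fun z => ?_
      have hd' : (0 : ℝ) < d := by exact_mod_cast hd
      rw [norm_mul, Real.norm_of_nonneg (by positivity), Real.norm_eq_abs]
      refine (mul_le_mul_of_nonneg_left (hK _) (by positivity)).trans (le_of_eq ?_)
      rw [div_pow, Real.sq_sqrt hd'.le]
      field_simp
    · refine Eventually.of_forall fun z => ?_
      rcases eq_or_ne z 0 with rfl | hz0
      · have : g 0 = 0 := by simp [hgdef, hW]
        simp [this]
      · have ht : Tendsto (fun d : ℕ => ℓ * z / √d) atTop (𝓝[≠] 0) := by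
          rw [tendsto_nhdsWithin_iff]
          constructor
          · exact Tendsto.const_div_atTop
              (Real.tendsto_sqrt_atTop.comp tendsto_natCast_atTop_atTop) _
          · filter_upwards [eventually_gt_atTop 0] with d hd
            have hd' : (0 : ℝ) < d := by exact_mod_cast hd
            exact div_ne_zero (mul_ne_zero hℓ.ne' hz0) (Real.sqrt_pos.2 hd').ne'
        have h := (hlim.comp ht).const_mul (2 * ℓ ^ 2 * z ^ 2)
        have e : 2 * ℓ ^ 2 * z ^ 2 * (-I / 8) = -(ℓ ^ 2 * I) / 4 * z ^ 2 := by ring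
        rw [e] at h
        refine h.congr' ?_
        filter_upwards [eventually_gt_atTop 0] with d hd
        have hd' : (0 : ℝ) < d := by exact_mod_cast hd
        simp only [Function.comp]
        rw [div_pow, Real.sq_sqrt hd'.le]
        field_simp
        try rfl
  rw [integral_const_mul, hvar, mul_one] at hgoal
  refine hgoal.congr fun d => ?_
  rw [hfub, integral_const_mul]
end
end
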